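/- Let θ0, θ1 ∈ (−π, π) with θ0 ≠ θ1, and let θ⋆ = −(θ0 + θ1)/2. If (s, t) ∈ ℝ² satisfies A·(s, t)ᵀ = (1, 0)ᵀ for the associated biarc matrix A, then s > 0 and t > 0; hence the standard-form biarc interpolation problem admits a solution with positive normalized arc lengths. -/

import Mathlib

noncomputable def sinc (x : ℝ) : ℝ := if x = 0 then 1 else Real.sin x / x
noncomputable def cosc (x : ℝ) : ℝ := if x = 0 then 0 else (1 - Real.cos x) / x

/-- The associated biarc matrix. -/
noncomputable def biarcA (θ0 θ1 θs : ℝ) : Matrix (Fin 2) (Fin 2) ℝ :=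
  !![Real.cos θ0 * sinc (θs - θ0) - Real.sin θ0 * cosc (θs - θ0),
     Real.cos θ1 * sinc (θs - θ1) - Real.sin θ1 * cosc (θs - θ1);
     Real.sin θ0 * sinc (θs - θ0) + Real.cos θ0 * cosc (θs - θ0),
     Real.sin θ1 * sinc (θs - θ1) + Real.cos θ1 * cosc (θs - θ1)]


theorem sinc_pos_of_mem_Ioo {x : ℝ} (hx : x ∈ Set.Ioo (-Real.pi) Real.pi) : 0 < sinc x := by
  unfold sinc
  split_ifs with h
  · exact one_pos
  · rcases lt_or_gt_of_ne h with h | h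
    · exact div_pos_of_neg_of_neg (Real.sin_neg_of_neg_of_neg_pi_lt h hx.1) h
    · exact div_pos (Real.sin_pos_of_pos_of_lt_pi h hx.2) h

theorem cos_mul_sinc_sub_sin_mul_cosc (a d : ℝ) :
    Real.cos a * sinc d - Real.sin a * cosc d = Real.cos (a + d / 2) * sinc (d / 2) := by
  rcases eq_or_ne d 0 with rfl | hd
  · simp [sinc, cosc]
  · have h : Real.sin (a + d) - Real.sin a = 2 * Real.sin (d / 2) * Real.cos (a + d / 2) := by
      rw [Real.sin_sub_sin]
      ring_nf
    rw [Real.sin_add] at h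
    simp only [sinc, cosc, if_neg hd, if_neg (div_ne_zero hd two_ne_zero)]
    generalize a + d / 2 = m at h ⊢
    field_simp
    linarith

theorem sin_mul_sinc_add_cos_mul_cosc (a d : ℝ) :
    Real.sin a * sinc d + Real.cos a * cosc d = Real.sin (a + d / 2) * sinc (d / 2) := by
  rcases eq_or_ne d 0 with rfl | hd
  · simp [sinc, cosc]
  · have h : Real.cos (a + d) - Real.cos a = -2 * Real.sin (a + d / 2) * Real.sin (d / 2) := by
      rw [Real.cos_sub_cos]
      ring_nf
    rw [Real.cos_add] at h
    simp only [sinc, cosc, if_neg hd, if_neg (div_ne_zero hd two_ne_zero)]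
    generalize a + d / 2 = m at h ⊢
    field_simp
    linarith

theorem biarc_solution_positive (θ0 θ1 : ℝ)
    (h0 : θ0 ∈ Set.Ioo (-Real.pi) Real.pi) (h1 : θ1 ∈ Set.Ioo (-Real.pi) Real.pi)
    (hne : θ0 ≠ θ1) (s t : ℝ)
    (hst : (biarcA θ0 θ1 (-(θ0 + θ1) / 2)).mulVec ![s, t] = ![1, 0]) :
    0 < s ∧ 0 < t := by
  obtain ⟨h0l, h0r⟩ := h0
  obtain ⟨h1l, h1r⟩ := h1
  have hc := congrFun hst 0
  have hs := congrFun hst 1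
  simp only [biarcA, cos_mul_sinc_sub_sin_mul_cosc, sin_mul_sinc_add_cos_mul_cosc,
    Matrix.mulVec, dotProduct, Fin.sum_univ_two, Matrix.of_apply, Matrix.cons_val_zero,
    Matrix.cons_val_one] at hc hs
  have hm0 : θ0 + (-(θ0 + θ1) / 2 - θ0) / 2 = (θ0 - θ1) / 4 := by ring
  have hm1 : θ1 + (-(θ0 + θ1) / 2 - θ1) / 2 = -((θ0 - θ1) / 4) := by ring
  rw [hm0, hm1, Real.cos_neg] at hc
  rw [hm0, hm1, Real.sin_neg] at hs
  have hS0 : 0 < sinc ((-(θ0 + θ1) / 2 - θ0) / 2) :=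
    sinc_pos_of_mem_Ioo ⟨by linarith, by linarith⟩
  have hS1 : 0 < sinc ((-(θ0 + θ1) / 2 - θ1) / 2) :=
    sinc_pos_of_mem_Ioo ⟨by linarith, by linarith⟩
  have hcos : 0 < Real.cos ((θ0 - θ1) / 4) :=
    Real.cos_pos_of_mem_Ioo ⟨by linarith, by linarith⟩
  have hsin : Real.sin ((θ0 - θ1) / 4) ≠ 0 := by
    rw [Ne, Real.sin_eq_zero_iff_of_lt_of_lt (by linarith) (by linarith)]
    intro h
    exact hne (by linarith)
  generalize sinc ((-(θ0 + θ1) / 2 - θ0) / 2) = S0 at *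
  generalize sinc ((-(θ0 + θ1) / 2 - θ1) / 2) = S1 at *
  have heq : S0 * s = S1 * t := mul_left_cancel₀ hsin (by linarith)
  have hsum : Real.cos ((θ0 - θ1) / 4) * (2 * (S0 * s)) = 1 := by
    linear_combination hc + Real.cos ((θ0 - θ1) / 4) * heq
  have hpos : 0 < S0 * s := by
    have := pos_of_mul_pos_right (hsum ▸ one_pos) hcos.le
    linarith
  exact ⟨pos_of_mul_pos_right hpos hS0.le, pos_of_mul_pos_right (heq ▸ hpos) hS1.le⟩
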